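/- arXiv:2103.07728 — 2 statements merged into one kernel-verified Lean document; each statement's English description precedes it below -/
import Mathlib

section
/- Let σ be a stability condition on D^b(X) for a smooth projective variety X, let g: F → E be a morphism in D^b(X), and set F̃ := Cone(F → E)[−1]. Then for every real number a not in the interval [φ⁻(E) − 1, φ⁺(E)], the Harder–Narasimhan factor of F of phase a is isomorphic to the Harder–Narasimhan factor of F̃ of phase a: HN_σ^a(F) ≅ HN_σ^a(F̃). -/
/-!
# Bridgeland stability conditions: basic framework

We formalize slicings, Harder–Narasimhan filtrations, pre-stability conditions and
(numerical) stability conditions on a pretriangulated category `D`, following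
Bridgeland and the conventions of Fu–Li–Zhao, "Stability manifolds of varieties with
finite Albanese morphisms".
-/

open CategoryTheory CategoryTheory.Limits CategoryTheory.Pretriangulated
open scoped TensorProduct ENNReal

noncomputable section

namespace BridgelandStability

universe w v u

variable (D : Type u) [Category.{v} D] [HasZeroObject D] [Preadditive D]
  [HasShift D ℤ] [∀ n : ℤ, (CategoryTheory.shiftFunctor D n).Additive] [Pretriangulated D]

/-- A Harder–Narasimhan filtration of an object `E` with respect to a collection of
full subcategories `P φ` (`φ ∈ ℝ`): a finite tower of distinguished triangles
`0 = E₀ → E₁ → ⋯ → E_m = E` whose cones (the HN factors) `Aᵢ` are nonzero objects of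
`P φᵢ` with strictly decreasing phases `φ₁ > ⋯ > φ_m`. -/
structure HNFiltration (P : ℝ → Set D) (E : D) where
  n : ℕ
  phase : Fin n → ℝ
  phase_strictAnti : StrictAnti phase
  obj : Fin (n + 1) → D
  obj_zero : IsZero (obj 0)
  obj_last : obj (Fin.last n) = E
  factor : Fin n → D
  factor_mem : ∀ i, factor i ∈ P (phase i)
  factor_nonzero : ∀ i, ¬ IsZero (factor i)
  factor_triangle : ∀ i : Fin n,
    ∃ (f : obj i.castSucc ⟶ obj i.succ) (g : obj i.succ ⟶ factor i)
      (h : factor i ⟶ (obj i.castSucc)⟦(1 : ℤ)⟧),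
      Triangle.mk f g h ∈ (distTriang D)

/-- A slicing of the triangulated category `D` (Bridgeland): full additive subcategories
`P φ` indexed by `φ ∈ ℝ` with `P (φ)[1] = P (φ + 1)`, no morphisms from higher to lower
phase, and Harder–Narasimhan filtrations for every object. -/
structure Slicing where
  P : ℝ → Set D
  iso_closed : ∀ (φ : ℝ) (E F : D), E ∈ P φ → Nonempty (E ≅ F) → F ∈ P φ
  zero_mem : ∀ (φ : ℝ) (E : D), IsZero E → E ∈ P φ
  shift_mem : ∀ (φ : ℝ) (E : D), E ∈ P φ ↔ (E⟦(1 : ℤ)⟧ ∈ P (φ + 1))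
  hom_vanish : ∀ ⦃φ ψ : ℝ⦄, ψ < φ → ∀ ⦃E F : D⦄, E ∈ P φ → F ∈ P ψ →
    ∀ f : E ⟶ F, f = 0
  hn_exists : ∀ E : D, Nonempty (HNFiltration D P E)

variable {D}

namespace Slicing

/-- A nonzero object of `P φ` is semistable of phase `φ`. -/
def IsSemistable (S : Slicing D) (φ : ℝ) (E : D) : Prop := E ∈ S.P φ ∧ ¬ IsZero E

/-- A stable object of phase `φ` is a simple object of the (abelian) category `P φ`:
it is semistable and admits no proper nontrivial subobject in `P φ`, where subobjects and
quotients in `P φ` are encoded by distinguished triangles `A → E → B → A[1]` with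
`A, B ∈ P φ`. -/
def IsStable (S : Slicing D) (φ : ℝ) (E : D) : Prop :=
  S.IsSemistable φ E ∧
    ∀ (A B : D) (f : A ⟶ E) (g : E ⟶ B) (h : B ⟶ A⟦(1 : ℤ)⟧),
      Triangle.mk f g h ∈ (distTriang D) → A ∈ S.P φ → B ∈ S.P φ → IsZero A ∨ IsZero B

/-- The set of phases of the (nonzero) Harder–Narasimhan factors of `E`. -/
def hnPhases (S : Slicing D) (E : D) : Set ℝ :=
  {φ : ℝ | ∃ (h : HNFiltration D S.P E) (i : Fin h.n), h.phase i = φ}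

/-- `φ⁺(E)`: the largest HN phase of `E`. -/
def phasePlus (S : Slicing D) (E : D) : ℝ := sSup (S.hnPhases E)

/-- `φ⁻(E)`: the smallest HN phase of `E`. -/
def phaseMinus (S : Slicing D) (E : D) : ℝ := sInf (S.hnPhases E)

/-- `E ∈ P(I)`: `E` admits a HN filtration all of whose phases lie in `I`. -/
def memSlice (S : Slicing D) (I : Set ℝ) (E : D) : Prop :=
  ∃ h : HNFiltration D S.P E, ∀ i, h.phase i ∈ I

/-- `A` is (isomorphic to) the Harder–Narasimhan factor `HN^a(E)` of `E` of phase `a`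
(the zero object if no HN factor of `E` has phase `a`). -/
def IsHNFactorAt (S : Slicing D) (a : ℝ) (E A : D) : Prop :=
  ∃ h : HNFiltration D S.P E,
    (∃ i, h.phase i = a ∧ Nonempty (h.factor i ≅ A)) ∨
      ((∀ i, h.phase i ≠ a) ∧ IsZero A)

/-- `Y` is (isomorphic to) the truncated Harder–Narasimhan factor `HN^{≤ c}(E)`:
there is a distinguished triangle `W → E → Y → W[1]` with `W ∈ P((c, +∞))` and
`Y ∈ P((-∞, c])`. -/
def IsHNTruncLE (S : Slicing D) (c : ℝ) (E Y : D) : Prop :=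
  ∃ (W : D) (f : W ⟶ E) (g : E ⟶ Y) (h : Y ⟶ W⟦(1 : ℤ)⟧),
    Triangle.mk f g h ∈ (distTriang D) ∧ S.memSlice (Set.Ioi c) W ∧
      S.memSlice (Set.Iic c) Y

/-- `A` is a subquotient of `H` inside the abelian category `P φ`:  there are
distinguished triangles `W → H → Q → W[1]` and `U → W → A → U[1]` with all objects in
`P φ`. -/
def IsSubquotientAt (S : Slicing D) (φ : ℝ) (A H : D) : Prop :=
  ∃ (W Q U : D) (f : W ⟶ H) (g : H ⟶ Q) (h : Q ⟶ W⟦(1 : ℤ)⟧)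
    (f' : U ⟶ W) (g' : W ⟶ A) (h' : A ⟶ U⟦(1 : ℤ)⟧),
    Triangle.mk f g h ∈ (distTriang D) ∧ Triangle.mk f' g' h' ∈ (distTriang D) ∧
      W ∈ S.P φ ∧ Q ∈ S.P φ ∧ U ∈ S.P φ ∧ A ∈ S.P φ

/-- `A` is a Jordan–Hölder factor of `E`: a stable subquotient (in `P φ`) of a
Harder–Narasimhan factor of `E` of some phase `φ`. -/
def IsJHFactorOf (S : Slicing D) (E A : D) : Prop :=
  ∃ (φ : ℝ) (H : D), S.IsHNFactorAt φ E H ∧ S.IsStable φ A ∧ S.IsSubquotientAt φ A H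

end Slicing

variable (D)

/-- A Bridgeland pre-stability condition: a slicing together with a compatible central
charge `Z`, viewed as a function on objects that is additive on distinguished triangles
(equivalently, a group homomorphism `K(D) → ℂ`). -/
structure PreStability where
  slicing : Slicing D
  Z : D → ℂ
  Z_zero : ∀ E : D, IsZero E → Z E = 0
  Z_additive : ∀ T : Triangle D, T ∈ (distTriang D) → Z T.obj₂ = Z T.obj₁ + Z T.obj₃
  Z_phase : ∀ (φ : ℝ) (E : D), E ∈ slicing.P φ → ¬ IsZero E →
    ∃ m : ℝ, 0 < m ∧ Z E = (m : ℂ) * Complex.exp ((Real.pi * φ : ℝ) * Complex.I)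

/-- A Bridgeland stability condition: a pre-stability condition whose central charge
factors through a surjection `v : K(D) ↠ Λ` onto a finite-rank free abelian group and
which satisfies the support property: there is a quadratic form `Q` on `Λ ⊗ ℝ` which is
negative definite on `ker Z` and nonnegative on classes of semistable objects. -/
structure StabilityCondition extends PreStability D where
  Λ : Type w
  [Λ_addCommGroup : AddCommGroup Λ]
  Λ_free : Module.Free ℤ Λ
  Λ_finite : Module.Finite ℤ Λ
  v : D → Λ
  v_zero : ∀ E : D, IsZero E → v E = 0
  v_additive : ∀ T : Triangle D, T ∈ (distTriang D) → v T.obj₂ = v T.obj₁ + v T.obj₃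
  v_surjective : AddSubgroup.closure (Set.range v) = ⊤
  ZΛ : Λ →+ ℂ
  Z_factors : ∀ E : D, Z E = ZΛ (v E)
  support_property :
    ∃ (Q : QuadraticForm ℝ (ℝ ⊗[ℤ] Λ)) (ZR : (ℝ ⊗[ℤ] Λ) →ₗ[ℝ] ℂ),
      (∀ a : Λ, ZR ((1 : ℝ) ⊗ₜ[ℤ] a) = ZΛ a) ∧
      (∀ x : ℝ ⊗[ℤ] Λ, ZR x = 0 → x ≠ 0 → Q x < 0) ∧
      (∀ (φ : ℝ) (E : D), E ∈ slicing.P φ → ¬ IsZero E → 0 ≤ Q ((1 : ℝ) ⊗ₜ[ℤ] v E))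

variable {D}

/-- A stability condition is numerical (with respect to the Euler pairing `χ` of `D`) if
the map to the lattice `Λ` factors through the numerical Grothendieck group, i.e. through
the quotient of `K(D)` by the radical of `χ`. -/
def StabilityCondition.IsNumerical (σ : StabilityCondition.{w} D) (χ : D → D → ℤ) : Prop :=
  ∀ E F : D, (∀ G : D, χ E G = χ F G) → (∀ G : D, χ G E = χ G F) → σ.v E = σ.v F

variable (D)

/-- A filtration of `E` by distinguished triangles whose factors satisfy `C`. -/
def HasFiltrationWithFactors (C : D → Prop) (E : D) : Prop :=
  ∃ (n : ℕ) (obj : Fin (n + 1) → D) (fac : Fin n → D),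
    IsZero (obj 0) ∧ obj (Fin.last n) = E ∧ (∀ i, C (fac i)) ∧
    ∀ i : Fin n, ∃ (f : obj i.castSucc ⟶ obj i.succ) (g : obj i.succ ⟶ fac i)
      (h : fac i ⟶ (obj i.castSucc)⟦(1 : ℤ)⟧), Triangle.mk f g h ∈ (distTriang D)

variable (V : Type) [NormedAddCommGroup V] [NormedSpace ℝ V] [FiniteDimensional ℝ V]

/-- A stability condition with respect to a fixed additive map `v` from objects of `D`
to a finite-dimensional real vector space `V` (whose image generates the lattice `Λ`,
e.g. `Λ_H`):  a slicing and a central charge factoring as `Z = Z_V ∘ v`, satisfying the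
support property: some quadratic form `Q` on `Λ ⊗ ℝ = span(im v)` is negative definite
on `ker Z` and nonnegative on classes of semistable objects. -/
structure StabilityConditionWrt (v : D → V) where
  slicing : Slicing D
  ZV : V →ₗ[ℝ] ℂ
  Z_phase : ∀ (φ : ℝ) (E : D), E ∈ slicing.P φ → ¬ IsZero E →
    ∃ m : ℝ, 0 < m ∧ ZV (v E) = (m : ℂ) * Complex.exp ((Real.pi * φ : ℝ) * Complex.I)
  support_property :
    ∃ Q : QuadraticForm ℝ V,
      (∀ x : V, x ∈ Submodule.span ℝ (Set.range v) → ZV x = 0 → x ≠ 0 → Q x < 0) ∧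
      (∀ (φ : ℝ) (E : D), E ∈ slicing.P φ → ¬ IsZero E → 0 ≤ Q (v E))

variable {D V}

/-- The generalized (extended) distance between two stability conditions:
`sup_E max(|φ⁺_σ(E) - φ⁺_τ(E)|, |φ⁻_σ(E) - φ⁻_τ(E)|) ⊔ ‖Z_σ - Z_τ‖`. -/
def stabDist {v : D → V} (σ τ : StabilityConditionWrt D V v) : ℝ≥0∞ :=
  (⨆ E : D, ENNReal.ofReal
      (max |σ.slicing.phasePlus E - τ.slicing.phasePlus E|
        |σ.slicing.phaseMinus E - τ.slicing.phaseMinus E|)) ⊔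
    ENNReal.ofReal ‖LinearMap.toContinuousLinearMap (σ.ZV - τ.ZV)‖

/-- The metric topology on the space of stability conditions `Stab_Λ`, generated by the
open balls of the generalized metric `stabDist`. -/
def stabTopology {v : D → V} : TopologicalSpace (StabilityConditionWrt D V v) :=
  TopologicalSpace.generateFrom
    {U | ∃ (σ : StabilityConditionWrt D V v) (ε : ℝ≥0∞), 0 < ε ∧
      U = {τ | stabDist σ τ < ε}}

/-- An object `G` of a heart `A ⊆ D` which is semistable with respect to the central
charge `Z` (on the heart): no subobject of `G` in `A` (encoded by a distinguished
triangle `U → G → Q → U[1]` with `U, Q ∈ A`) has strictly larger phase, phases being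
measured by the argument of `Z`. -/
def heartSemistable (A : Set D) (Z : D → ℂ) (G : D) : Prop :=
  G ∈ A ∧ ¬ IsZero G ∧
    ∀ (U Q : D) (f : U ⟶ G) (g : G ⟶ Q) (h : Q ⟶ U⟦(1 : ℤ)⟧),
      Triangle.mk f g h ∈ (distTriang D) → U ∈ A → Q ∈ A → ¬ IsZero U → ¬ IsZero Q →
        (Z U).arg ≤ (Z G).arg

/-- The slicing obtained from a heart `A` together with a central charge `Z` mapping
nonzero objects of `A` to the semi-closed upper half plane: `P(φ)` for `φ ∈ (0,1]`
consists of the `Z`-semistable objects of `A` of phase `φ = arg(Z)/π`, and it is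
extended to all `φ ∈ ℝ` by `P(φ + n) = P(φ)[n]`. -/
def heartSlicingP (A : Set D) (Z : D → ℂ) : ℝ → Set D := fun φ =>
  {F : D | IsZero F ∨ ∃ (n : ℤ) (G : D), heartSemistable A Z G ∧
    (Z G).arg = Real.pi * (φ - n) ∧ 0 < φ - (n : ℝ) ∧ φ - (n : ℝ) ≤ 1 ∧
      Nonempty (F ≅ G⟦n⟧)}

/-- The universal cover `G̃L⁺₂(ℝ)` of `GL⁺₂(ℝ)`: pairs `(L, f)` of an
orientation-preserving `ℝ`-linear automorphism `L` of `ℂ = ℝ²` together with a lift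
`f : ℝ → ℝ` of its action on the rays of `ℂ`, i.e. `f` is an increasing function with
`f(φ + 1) = f(φ) + 1` and `L(exp(iπ f(φ))) ∈ ℝ_{>0} · exp(iπφ)`. -/
structure GLtildePlus where
  L : ℂ ≃ₗ[ℝ] ℂ
  det_pos : 0 < LinearMap.det (L : ℂ →ₗ[ℝ] ℂ)
  f : ℝ → ℝ
  f_mono : StrictMono f
  f_shift : ∀ φ : ℝ, f (φ + 1) = f φ + 1
  compat : ∀ φ : ℝ, ∃ r : ℝ, 0 < r ∧
    L (Complex.exp ((Real.pi * f φ : ℝ) * Complex.I)) =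
      (r : ℂ) * Complex.exp ((Real.pi * φ : ℝ) * Complex.I)

/-- The topology on `G̃L⁺₂(ℝ)` (induced by pointwise convergence of the data). -/
def GLtildePlus.topology : TopologicalSpace GLtildePlus :=
  TopologicalSpace.induced (fun g => (g.f, (g.L : ℂ → ℂ))) inferInstance

/-- `σ = σ₀ · g` for some `g ∈ G̃L⁺₂(ℝ)`, where `σ₀` is the stability condition with
heart `A` and central charge `Z₀`:  there is `g = (L, f)` in `G̃L⁺₂(ℝ)` with
`P_σ(φ) = P_{σ₀}(f(φ))` for all `φ` and `Z_σ = L ∘ Z₀`. -/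
def IsGLtildeTranslateOf {v : D → V} (σ : StabilityConditionWrt D V v)
    (A : Set D) (Z₀ : D → ℂ) : Prop :=
  ∃ g : GLtildePlus,
    (∀ φ : ℝ, σ.slicing.P φ = heartSlicingP A Z₀ (g.f φ)) ∧
    (∀ E : D, σ.ZV (v E) = g.L (Z₀ E))


/-- Morphisms out of `X⟦1⟧` vanish if the corresponding morphisms to the inverse shift do. -/
lemma shift_hom_eq_zero {C : Type*} [Category C] [Preadditive C] [HasShift C ℤ]
    [(shiftFunctor C (1 : ℤ)).Additive] {X Y : C} (h : ∀ f : X ⟶ Y⟦(-1 : ℤ)⟧, f = 0)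
    (g : X⟦(1 : ℤ)⟧ ⟶ Y) : g = 0 := by
  let e : (Y⟦(-1 : ℤ)⟧)⟦(1 : ℤ)⟧ ≅ Y := (shiftFunctorCompIsoId C (-1 : ℤ) 1 (by simp)).app Y
  obtain ⟨f, hf⟩ := (shiftFunctor C (1 : ℤ)).map_surjective (g ≫ e.inv)
  rw [h f, Functor.map_zero] at hf
  rw [← cancel_mono e.inv, ← hf, zero_comp]

/-- Two objects of a class `W` with the same morphisms from objects of `W` to `F` are
isomorphic. -/
lemma nonempty_iso_of_coreflections {C : Type*} [Category C] [Preadditive C]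
    {W : C → Prop} {H H' F : C} (hH : W H) (hH' : W H')
    {i : H ⟶ F} {i' : H' ⟶ F}
    (hi : ∀ X, W X → (∀ f : X ⟶ F, ∃ g, g ≫ i = f) ∧ ∀ g : X ⟶ H, g ≫ i = 0 → g = 0)
    (hi' : ∀ X, W X → (∀ f : X ⟶ F, ∃ g, g ≫ i' = f) ∧ ∀ g : X ⟶ H', g ≫ i' = 0 → g = 0) :
    Nonempty (H ≅ H') := by
  obtain ⟨u, hu⟩ := (hi' H hH).1 i
  obtain ⟨w, hw⟩ := (hi H' hH').1 i'
  exact ⟨⟨u, w,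
    sub_eq_zero.1 ((hi H hH).2 _ (by simp [Preadditive.sub_comp, hu, hw])),
    sub_eq_zero.1 ((hi' H' hH').2 _ (by simp [Preadditive.sub_comp, hu, hw]))⟩⟩

/-- Two objects of a class `W` with the same morphisms from `F` to objects of `W` are
isomorphic. -/
lemma nonempty_iso_of_reflections {C : Type*} [Category C] [Preadditive C]
    {W : C → Prop} {Q Q' F : C} (hQ : W Q) (hQ' : W Q')
    {q : F ⟶ Q} {q' : F ⟶ Q'}
    (hq : ∀ Y, W Y → (∀ f : F ⟶ Y, ∃ g, q ≫ g = f) ∧ ∀ g : Q ⟶ Y, q ≫ g = 0 → g = 0)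
    (hq' : ∀ Y, W Y → (∀ f : F ⟶ Y, ∃ g, q' ≫ g = f) ∧ ∀ g : Q' ⟶ Y, q' ≫ g = 0 → g = 0) :
    Nonempty (Q ≅ Q') := by
  obtain ⟨u, hu⟩ := (hq Q' hQ').1 q'
  obtain ⟨w, hw⟩ := (hq' Q hQ).1 q
  exact ⟨⟨u, w,
    sub_eq_zero.1 ((hq Q hQ).2 _ (by simp [Preadditive.comp_sub, reassoc_of% hu, hw])),
    sub_eq_zero.1 ((hq' Q' hQ').2 _ (by simp [Preadditive.comp_sub, reassoc_of% hw, hu]))⟩⟩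

namespace Slicing

/-- `X` has no nonzero morphism to a semistable object whose phase lies in `J`. -/
def LeftOrth (S : Slicing D) (J : Set ℝ) (X : D) : Prop :=
  ∀ ψ ∈ J, ∀ Y ∈ S.P ψ, ∀ f : X ⟶ Y, f = 0

/-- `Y` has no nonzero morphism from a semistable object whose phase lies in `J`. -/
def RightOrth (S : Slicing D) (J : Set ℝ) (Y : D) : Prop :=
  ∀ φ ∈ J, ∀ X ∈ S.P φ, ∀ f : X ⟶ Y, f = 0

variable {S : Slicing D}

lemma LeftOrth.mono {J K : Set ℝ} {X : D} (hX : S.LeftOrth J X) (h : K ⊆ J) :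
    S.LeftOrth K X := fun ψ hψ => hX ψ (h hψ)

lemma RightOrth.mono {J K : Set ℝ} {Y : D} (hY : S.RightOrth J Y) (h : K ⊆ J) :
    S.RightOrth K Y := fun φ hφ => hY φ (h hφ)

lemma leftOrth_of_mem {J : Set ℝ} {φ : ℝ} {X : D} (hX : X ∈ S.P φ) (h : ∀ ψ ∈ J, ψ < φ) :
    S.LeftOrth J X := fun ψ hψ _ hY f => S.hom_vanish (h ψ hψ) hX hY f

lemma rightOrth_of_mem {J : Set ℝ} {ψ : ℝ} {Y : D} (hY : Y ∈ S.P ψ) (h : ∀ φ ∈ J, ψ < φ) :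
    S.RightOrth J Y := fun φ hφ _ hX f => S.hom_vanish (h φ hφ) hX hY f

lemma shift_neg_mem {φ : ℝ} {Y : D} (hY : Y ∈ S.P φ) : Y⟦(-1 : ℤ)⟧ ∈ S.P (φ - 1) := by
  rw [S.shift_mem, sub_add_cancel]
  exact S.iso_closed φ _ _ hY ⟨((shiftFunctorCompIsoId D (-1 : ℤ) 1 (by simp)).app Y).symm⟩

lemma LeftOrth.shift {J : Set ℝ} {X : D} (hX : S.LeftOrth J X) (hJ : ∀ ψ ∈ J, ψ - 1 ∈ J) :
    S.LeftOrth J (X⟦(1 : ℤ)⟧) := fun ψ hψ _ hY g =>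
  shift_hom_eq_zero (hX (ψ - 1) (hJ ψ hψ) _ (shift_neg_mem hY)) g

lemma RightOrth.shift {a : ℝ} {Y : D} (hY : S.RightOrth (Set.Ioi a) Y) :
    S.RightOrth (Set.Ioi (a + 1)) (Y⟦(1 : ℤ)⟧) := fun φ hφ X hX g => by
  let e : (X⟦(-1 : ℤ)⟧)⟦(1 : ℤ)⟧ ≅ X := (shiftFunctorCompIsoId D (-1 : ℤ) 1 (by simp)).app X
  obtain ⟨f, hf⟩ := (shiftFunctor D (1 : ℤ)).map_surjective (e.hom ≫ g)
  have hφ' : a < φ - 1 := lt_sub_iff_add_lt.2 hφ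
  rw [hY (φ - 1) hφ' _ (shift_neg_mem hX) f, Functor.map_zero] at hf
  rw [← cancel_epi e.hom, ← hf, comp_zero]

lemma RightOrth.shift_neg {J : Set ℝ} {Y : D} (hY : S.RightOrth J Y)
    (hJ : ∀ φ ∈ J, φ + 1 ∈ J) : S.RightOrth J (Y⟦(-1 : ℤ)⟧) := fun φ hφ X hX f => by
  let e : (Y⟦(-1 : ℤ)⟧)⟦(1 : ℤ)⟧ ≅ Y := (shiftFunctorCompIsoId D (-1 : ℤ) 1 (by simp)).app Y
  have h := hY (φ + 1) (hJ φ hφ) _ ((S.shift_mem φ X).1 hX) (f⟦(1 : ℤ)⟧' ≫ e.hom)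
  apply (shiftFunctor D (1 : ℤ)).map_injective
  rw [← cancel_mono e.hom, h, Functor.map_zero, zero_comp]

/-- `X` has no nonzero morphism to an object that is right orthogonal to the phases in `J`. -/
def StrongLeftOrth (S : Slicing D) (J : Set ℝ) (X : D) : Prop :=
  ∀ Y, S.RightOrth J Y → ∀ f : X ⟶ Y, f = 0

lemma StrongLeftOrth.leftOrth {J K : Set ℝ} {X : D} (hX : S.StrongLeftOrth J X)
    (h : ∀ ψ ∈ K, ∀ φ ∈ J, ψ < φ) : S.LeftOrth K X :=
  fun ψ hψ Y hY f => hX Y (rightOrth_of_mem hY (h ψ hψ)) f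

lemma StrongLeftOrth.shift {J : Set ℝ} {X : D} (hX : S.StrongLeftOrth J X)
    (hJ : ∀ φ ∈ J, φ + 1 ∈ J) : S.StrongLeftOrth J (X⟦(1 : ℤ)⟧) :=
  fun _ hY g => shift_hom_eq_zero (hX _ (hY.shift_neg hJ)) g

/-- Composition with `i` is surjective on morphisms out of objects left orthogonal to `J`, and
composition with `i⟦1⟧'` is injective on such morphisms. -/
def IsColocal (S : Slicing D) (J : Set ℝ) {H F : D} (i : H ⟶ F) : Prop :=
  ∀ X, S.LeftOrth J X → (∀ f : X ⟶ F, ∃ g : X ⟶ H, g ≫ i = f) ∧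
    ∀ g : X ⟶ H⟦(1 : ℤ)⟧, g ≫ i⟦(1 : ℤ)⟧' = 0 → g = 0

lemma IsColocal.mono {J K : Set ℝ} {H F : D} {i : H ⟶ F} (hi : S.IsColocal J i)
    (h : J ⊆ K) : S.IsColocal K i := fun X hX => hi X (hX.mono h)

lemma IsColocal.comp {J : Set ℝ} {G H F : D} {j : G ⟶ H} {i : H ⟶ F}
    (hj : S.IsColocal J j) (hi : S.IsColocal J i) : S.IsColocal J (j ≫ i) := by
  intro X hX
  refine ⟨fun f => ?_, fun g hg => ?_⟩
  · obtain ⟨g, rfl⟩ := (hi X hX).1 f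
    obtain ⟨k, rfl⟩ := (hj X hX).1 g
    exact ⟨k, (Category.assoc _ _ _).symm⟩
  · rw [Functor.map_comp, ← Category.assoc] at hg
    exact (hj X hX).2 g ((hi X hX).2 _ hg)

lemma isColocal_of_isIso (J : Set ℝ) {H F : D} (i : H ⟶ F) [IsIso i] : S.IsColocal J i :=
  fun _ _ => ⟨fun f => ⟨f ≫ inv i, by simp⟩, fun g hg => by
    rwa [← cancel_mono (i⟦(1 : ℤ)⟧'), zero_comp]⟩

lemma isColocal_of_triangle {J : Set ℝ} {U V B : D} {f : U ⟶ V} {g : V ⟶ B}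
    {h : B ⟶ U⟦(1 : ℤ)⟧} (hT : Triangle.mk f g h ∈ distTriang D)
    (hB : ∀ X, S.LeftOrth J X → ∀ x : X ⟶ B, x = 0) : S.IsColocal J f := by
  intro X hX
  refine ⟨fun x => ?_, fun x hx => ?_⟩
  · obtain ⟨y, hy⟩ := Triangle.coyoneda_exact₂ _ hT x (hB X hX _)
    exact ⟨y, hy.symm⟩
  · obtain ⟨y, hy⟩ : ∃ y : X ⟶ B, x = y ≫ h := Triangle.coyoneda_exact₁ _ hT x hx
    rw [hy, hB X hX y, zero_comp]

lemma IsColocal.eq_zero {J : Set ℝ} {H F X : D} {i : H ⟶ F} (hi : S.IsColocal J i)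
    (hJ : ∀ ψ ∈ J, ψ - 1 ∈ J) (hX : S.LeftOrth J X) (g : X ⟶ H) (hg : g ≫ i = 0) : g = 0 := by
  apply (shiftFunctor D (1 : ℤ)).map_injective
  rw [Functor.map_zero]
  refine (hi _ (hX.shift hJ)).2 _ ?_
  rw [← Functor.map_comp, hg, Functor.map_zero]

/-- The third term of a triangle on `G` is a reflection away from `G`. -/
lemma reflection_of_triangle {a : ℝ} {G H A : D} {j : G ⟶ H} {p : H ⟶ A}
    {d : A ⟶ G⟦(1 : ℤ)⟧} (hT : Triangle.mk j p d ∈ distTriang D)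
    (hG : S.StrongLeftOrth (Set.Ioi a) G) (Y : D) (hY : S.RightOrth (Set.Ioi a) Y) :
    (∀ f : H ⟶ Y, ∃ g, p ≫ g = f) ∧ ∀ g : A ⟶ Y, p ≫ g = 0 → g = 0 := by
  refine ⟨fun f => ?_, fun g hg => ?_⟩
  · obtain ⟨g, hg⟩ := Triangle.yoneda_exact₂ _ hT f (hG Y hY _)
    exact ⟨g, hg.symm⟩
  · obtain ⟨k, hk⟩ : ∃ k : G⟦(1 : ℤ)⟧ ⟶ Y, g = d ≫ k := Triangle.yoneda_exact₃ _ hT g hg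
    have hk0 : k = 0 := hG.shift (fun φ hφ => lt_trans hφ (lt_add_one φ)) Y hY k
    rw [hk, hk0, comp_zero]

end Slicing

namespace HNFiltration

variable {S : Slicing D} {E : D} (h : HNFiltration D S.P E)

lemma hom_to_obj_eq_zero {J : Set ℝ} {X : D} (hX : S.LeftOrth J X) (k : Fin (h.n + 1))
    (hk : ∀ j : Fin h.n, j.castSucc < k → h.phase j ∈ J) (f : X ⟶ h.obj k) : f = 0 := by
  induction k using Fin.induction with
  | zero => exact h.obj_zero.eq_of_tgt _ _
  | succ i ih =>
    obtain ⟨u, p, d, hT⟩ := h.factor_triangle i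
    obtain ⟨y, hy⟩ : ∃ y : X ⟶ h.obj i.castSucc, f = y ≫ u := Triangle.coyoneda_exact₂ _ hT f
      (hX _ (hk i i.castSucc_lt_succ) _ (h.factor_mem i) _)
    have hy0 : y = 0 := ih (fun j hj => hk j (hj.trans i.castSucc_lt_succ)) y
    rw [hy, hy0, zero_comp]

lemma strongLeftOrth_obj {J : Set ℝ} (k : Fin (h.n + 1))
    (hk : ∀ j : Fin h.n, j.castSucc < k → h.phase j ∈ J) : S.StrongLeftOrth J (h.obj k) := by
  intro Y hY f
  induction k using Fin.induction with
  | zero => exact h.obj_zero.eq_of_src _ _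
  | succ i ih =>
    obtain ⟨u, p, d, hT⟩ := h.factor_triangle i
    obtain ⟨y, hy⟩ : ∃ y : h.factor i ⟶ Y, f = p ≫ y := Triangle.yoneda_exact₂ _ hT f
      (ih (fun j hj => hk j (hj.trans i.castSucc_lt_succ)) _)
    have hy0 : y = 0 := hY _ (hk i i.castSucc_lt_succ) _ (h.factor_mem i) y
    rw [hy, hy0, comp_zero]

lemma hom_to_eq_zero {J : Set ℝ} {X : D} (hX : S.LeftOrth J X)
    (hJ : ∀ j, h.phase j ∈ J) (f : X ⟶ E) : f = 0 := by
  have hf := h.hom_to_obj_eq_zero hX (Fin.last _) (fun j _ => hJ j) (f ≫ eqToHom h.obj_last.symm)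
  rwa [← cancel_mono (eqToHom h.obj_last.symm), zero_comp]

lemma strongLeftOrth {J : Set ℝ} (hJ : ∀ j, h.phase j ∈ J) : S.StrongLeftOrth J E := by
  have := h.strongLeftOrth_obj (Fin.last _) (fun j _ => hJ j)
  rwa [h.obj_last] at this

lemma exists_isColocal {J : Set ℝ} (k : Fin (h.n + 1))
    (hk : ∀ j : Fin h.n, k ≤ j.castSucc → h.phase j ∈ J) :
    ∃ i : h.obj k ⟶ E, S.IsColocal J i := by
  induction k using Fin.reverseInduction with
  | last => exact ⟨eqToHom h.obj_last, Slicing.isColocal_of_isIso _ _⟩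
  | cast i ih =>
    obtain ⟨u, p, d, hT⟩ := h.factor_triangle i
    obtain ⟨t, ht⟩ := ih (fun j hj => hk j (i.castSucc_lt_succ.le.trans hj))
    exact ⟨u ≫ t, (Slicing.isColocal_of_triangle hT
      (fun X hX x => hX _ (hk i le_rfl) _ (h.factor_mem i) x)).comp ht⟩

/-- The position in the filtration separating phases above `a` from the others. -/
lemma exists_cut (a : ℝ) : ∃ k : Fin (h.n + 1), (∀ j : Fin h.n, j.castSucc < k → a < h.phase j) ∧
    ∀ j : Fin h.n, k ≤ j.castSucc → h.phase j ≤ a := by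
  by_cases hex : ∃ j, h.phase j ≤ a
  · obtain ⟨j, hj, hmin⟩ := (Set.toFinite {j | h.phase j ≤ a}).exists_minimal hex
    refine ⟨j.castSucc, fun i hi => ?_, fun i hi => ?_⟩
    · by_contra! hia
      exact absurd (hmin hia (Fin.castSucc_lt_castSucc_iff.1 hi).le)
        (Fin.castSucc_lt_castSucc_iff.1 hi).not_ge
    · exact (h.phase_strictAnti.antitone (Fin.castSucc_le_castSucc_iff.1 hi)).trans hj
  · push Not at hex
    exact ⟨Fin.last _, fun j _ => hex j, fun j hj => absurd j.castSucc_lt_last hj.not_gt⟩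

lemma phase_le {b : ℝ} (hb : ∀ i, h.phase i ≤ b) (h' : HNFiltration D S.P E) (j : Fin h'.n) :
    h'.phase j ≤ b := by
  by_contra! hj
  have hpos : 0 < h'.n := j.pos
  let z : Fin h'.n := ⟨0, hpos⟩
  have hz : b < h'.phase z := hj.trans_le (h'.phase_strictAnti.antitone (Nat.zero_le _))
  have hlast : ∀ i : Fin h'.n, z.succ ≤ i.castSucc → h'.phase i ∈ Set.Iio (h'.phase z) :=
    fun i hi => h'.phase_strictAnti (Fin.succ_le_castSucc_iff.1 hi)
  obtain ⟨t, ht⟩ := h'.exists_isColocal z.succ hlast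
  have hobj : S.LeftOrth (Set.Iio (h'.phase z)) (h'.obj z.succ) := by
    refine (h'.strongLeftOrth_obj (J := Set.Ici (h'.phase z)) _ fun i hi => ?_).leftOrth
      fun ψ hψ φ hφ => lt_of_lt_of_le hψ hφ
    exact h'.phase_strictAnti.antitone (Fin.castSucc_lt_succ_iff.1 hi)
  have hid := ht.eq_zero (fun ψ hψ => (sub_one_lt ψ).trans hψ) hobj (𝟙 _)
    (h.hom_to_eq_zero hobj (fun i => (hb i).trans_lt hz) _)
  obtain ⟨u, p, d, hT⟩ := h'.factor_triangle z
  exact h'.factor_nonzero z (Triangle.isZero₃_of_isZero₁₂ _ hT h'.obj_zero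
    ((IsZero.iff_id_eq_zero _).2 hid))

lemma le_phase {b : ℝ} (hb : ∀ i, b ≤ h.phase i) (h' : HNFiltration D S.P E) (j : Fin h'.n) :
    b ≤ h'.phase j := by
  by_contra! hj
  let z : Fin h'.n := ⟨h'.n - 1, by have := j.pos; omega⟩
  have hzle : ∀ i, i ≤ z := fun i => Nat.le_sub_one_of_lt i.2
  have hz : h'.phase z < b := (h'.phase_strictAnti.antitone (hzle j)).trans_lt hj
  have hsucc : z.succ = Fin.last _ := by
    have := j.pos
    ext
    simp only [z, Fin.val_succ, Fin.val_last]
    omega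
  have hE : S.StrongLeftOrth (Set.Ici b) (h'.obj z.succ) := by
    rw [hsucc, h'.obj_last]
    exact h.strongLeftOrth hb
  have hU : S.StrongLeftOrth (Set.Ioi (h'.phase z)) (h'.obj z.castSucc) :=
    h'.strongLeftOrth_obj _ fun i hi => h'.phase_strictAnti (Fin.castSucc_lt_castSucc_iff.1 hi)
  obtain ⟨u, p, d, hT⟩ := h'.factor_triangle z
  have hp : p ≫ 𝟙 _ = 0 :=
    hE _ (Slicing.rightOrth_of_mem (h'.factor_mem z) fun φ hφ => hz.trans_le hφ) _
  exact h'.factor_nonzero z ((IsZero.iff_id_eq_zero _).2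
    ((Slicing.reflection_of_triangle hT hU _
      (Slicing.rightOrth_of_mem (h'.factor_mem z) fun _ hφ => hφ)).2 _ hp))

end HNFiltration

namespace Slicing

variable {S : Slicing D}

lemma phase_le_phasePlus {E : D} (h : HNFiltration D S.P E) (i : Fin h.n) :
    h.phase i ≤ S.phasePlus E := by
  obtain ⟨b, hb⟩ := (Set.finite_range h.phase).bddAbove
  refine le_csSup ⟨b, ?_⟩ ⟨h, i, rfl⟩
  rintro _ ⟨h', j, rfl⟩
  exact h.phase_le (fun i => hb ⟨i, rfl⟩) h' j

lemma phaseMinus_le_phase {E : D} (h : HNFiltration D S.P E) (i : Fin h.n) :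
    S.phaseMinus E ≤ h.phase i := by
  obtain ⟨b, hb⟩ := (Set.finite_range h.phase).bddBelow
  refine csInf_le ⟨b, ?_⟩ ⟨h, i, rfl⟩
  rintro _ ⟨h', j, rfl⟩
  exact h.le_phase (fun i => hb ⟨i, rfl⟩) h' j

/-- The data `G = HN^{> a}(F) ⟶ H = HN^{≥ a}(F) ⟶ A = HN^a(F)` with its map to `F`. -/
structure HNCut (S : Slicing D) (a : ℝ) (F A : D) where
  G : D
  H : D
  j : G ⟶ H
  p : H ⟶ A
  d : A ⟶ G⟦(1 : ℤ)⟧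
  i : H ⟶ F
  triangle : Triangle.mk j p d ∈ distTriang D
  strongLeftOrth_G : S.StrongLeftOrth (Set.Ioi a) G
  strongLeftOrth_H : S.StrongLeftOrth (Set.Ici a) H
  mem : A ∈ S.P a
  isColocal : S.IsColocal (Set.Iio a) i

lemma IsHNFactorAt.exists_hnCut {a : ℝ} {F A : D} (hA : S.IsHNFactorAt a F A) :
    ∃ A₀ : D, Nonempty (A₀ ≅ A) ∧ Nonempty (S.HNCut a F A₀) := by
  obtain ⟨h, ⟨k, rfl, e⟩ | ⟨hne, hz⟩⟩ := hA
  · obtain ⟨u, p, d, hT⟩ := h.factor_triangle k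
    obtain ⟨i, hi⟩ := h.exists_isColocal (J := Set.Iio (h.phase k)) k.succ fun l hl =>
      h.phase_strictAnti (Fin.succ_le_castSucc_iff.1 hl)
    exact ⟨h.factor k, e, ⟨⟨_, _, u, p, d, i, hT,
      h.strongLeftOrth_obj _ fun l hl =>
        h.phase_strictAnti (Fin.castSucc_lt_castSucc_iff.1 hl),
      h.strongLeftOrth_obj _ fun l hl =>
        h.phase_strictAnti.antitone (Fin.castSucc_lt_succ_iff.1 hl),
      h.factor_mem k, hi⟩⟩⟩
  · obtain ⟨k, hk₁, hk₂⟩ := h.exists_cut a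
    obtain ⟨i, hi⟩ := h.exists_isColocal (J := Set.Iio a) k fun l hl =>
      lt_of_le_of_ne (hk₂ l hl) (hne l)
    exact ⟨_, ⟨(isZero_zero D).iso hz⟩, ⟨⟨h.obj k, h.obj k, 𝟙 _, 0, 0, i,
      contractible_distinguished _, h.strongLeftOrth_obj _ hk₁,
      h.strongLeftOrth_obj _ fun l hl => (hk₁ l hl).le, S.zero_mem _ _ (isZero_zero D), hi⟩⟩⟩

namespace HNCut

variable {a : ℝ} {F A : D} (c : S.HNCut a F A)

lemma leftOrth_H : S.LeftOrth (Set.Iio a) c.H :=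
  c.strongLeftOrth_H.leftOrth fun _ hψ _ hφ => lt_of_lt_of_le hψ hφ

lemma isColocal_comp : S.IsColocal (Set.Iic a) (c.j ≫ c.i) :=
  (isColocal_of_triangle c.triangle fun _ hX x => hX a Set.self_mem_Iic _ c.mem x).comp
    (c.isColocal.mono Set.Iio_subset_Iic_self)

/-- `HN^{≤ a}(F)`, the reflection of `F` in the objects right orthogonal to phases above `a`,
together with the coreflection `HN^a(F) ⟶ HN^{≤ a}(F)`. -/
lemma exists_quotient (c : S.HNCut a F A) :
    ∃ (Q : D) (q : F ⟶ Q) (r : A ⟶ Q), S.RightOrth (Set.Ioi a) Q ∧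
    (∀ Y, S.RightOrth (Set.Ioi a) Y →
      (∀ f : F ⟶ Y, ∃ g, q ≫ g = f) ∧ ∀ g : Q ⟶ Y, q ≫ g = 0 → g = 0) ∧
    ∀ X, S.LeftOrth (Set.Iio a) X →
      (∀ f : X ⟶ Q, ∃ g, g ≫ r = f) ∧ ∀ g : X ⟶ A, g ≫ r = 0 → g = 0 := by
  obtain ⟨Q, q, δ, hT⟩ := distinguished_cocone_triangle (c.j ≫ c.i)
  obtain ⟨r, hr₁, hr₂⟩ : ∃ r : A ⟶ Q, c.p ≫ r = c.i ≫ q ∧ c.d ≫ (𝟙 c.G)⟦(1 : ℤ)⟧' = r ≫ δ :=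
    complete_distinguished_triangle_morphism _ _ c.triangle hT (𝟙 c.G) c.i
      (Category.id_comp _).symm
  rw [CategoryTheory.Functor.map_id, Category.comp_id] at hr₂
  have hzq : (c.j ≫ c.i) ≫ q = 0 := comp_distTriang_mor_zero₁₂ _ hT
  have hzδ : δ ≫ (c.j ≫ c.i)⟦(1 : ℤ)⟧' = 0 := comp_distTriang_mor_zero₃₁ _ hT
  have hjp : c.j ≫ c.p = 0 := comp_distTriang_mor_zero₁₂ _ c.triangle
  refine ⟨Q, q, r, fun φ hφ X hX f => ?_, reflection_of_triangle hT c.strongLeftOrth_G,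
    fun X hX => ⟨fun f => ?_, fun g hg => ?_⟩⟩
  · have hX' : S.LeftOrth (Set.Iic a) X := leftOrth_of_mem hX fun ψ hψ => lt_of_le_of_lt hψ hφ
    have hfδ : f ≫ δ = 0 := (c.isColocal_comp X hX').2 _ (by rw [Category.assoc, hzδ, comp_zero])
    obtain ⟨y, rfl⟩ : ∃ y : X ⟶ F, f = y ≫ q := Triangle.coyoneda_exact₃ _ hT f hfδ
    obtain ⟨x, rfl⟩ := (c.isColocal_comp X hX').1 y
    rw [Category.assoc, hzq, comp_zero]
  · have hfj : (f ≫ δ) ≫ c.j⟦(1 : ℤ)⟧' = 0 := (c.isColocal X hX).2 _ (by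
      rw [Category.assoc, Category.assoc, ← Functor.map_comp, hzδ, comp_zero])
    obtain ⟨y, hy⟩ : ∃ y : X ⟶ A, f ≫ δ = y ≫ c.d := Triangle.coyoneda_exact₁ _ c.triangle _ hfj
    obtain ⟨x, hx⟩ : ∃ x : X ⟶ F, f - y ≫ r = x ≫ q := Triangle.coyoneda_exact₃ _ hT (f - y ≫ r)
      (by change (f - y ≫ r) ≫ δ = 0
          rw [Preadditive.sub_comp, Category.assoc, ← hr₂, hy, sub_self])
    obtain ⟨t, rfl⟩ := (c.isColocal X hX).1 x
    refine ⟨y + t ≫ c.p, ?_⟩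
    rw [Preadditive.add_comp, Category.assoc, hr₁, ← Category.assoc, ← hx]
    abel
  · obtain ⟨y, rfl⟩ : ∃ y : X ⟶ c.H, g = y ≫ c.p := Triangle.coyoneda_exact₃ _ c.triangle g (by
      change g ≫ c.d = 0
      rw [hr₂, ← Category.assoc, hg, zero_comp])
    rw [Category.assoc, hr₁, ← Category.assoc] at hg
    obtain ⟨s, hs⟩ : ∃ s : X ⟶ c.G, y ≫ c.i = s ≫ c.j ≫ c.i :=
      Triangle.coyoneda_exact₂ _ hT (y ≫ c.i) hg
    have hy : y = s ≫ c.j := sub_eq_zero.1 (c.isColocal.eq_zero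
      (fun ψ hψ => (sub_one_lt ψ).trans hψ) hX _ (by
        rw [Preadditive.sub_comp, hs, Category.assoc, sub_self]))
    rw [hy, Category.assoc, hjp, comp_zero]

end HNCut

/-- If `f : F' ⟶ F` is colocal for phases below `a`, then `F` and `F'` have the same
HN factor of phase `a`. -/
lemma HNCut.nonempty_iso_of_isColocal {a : ℝ} {F F' A A' : D} (c : S.HNCut a F A)
    (c' : S.HNCut a F' A') {f : F' ⟶ F} (hf : S.IsColocal (Set.Iio a) f) :
    Nonempty (A ≅ A') := by
  have hcolocal : ∀ {K : D} {i : K ⟶ F}, S.IsColocal (Set.Iio a) i → ∀ X,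
      S.LeftOrth (Set.Iio a) X →
        (∀ x : X ⟶ F, ∃ y, y ≫ i = x) ∧ ∀ y : X ⟶ K, y ≫ i = 0 → y = 0 :=
    fun hi X hX => ⟨(hi X hX).1, hi.eq_zero (fun ψ hψ => (sub_one_lt ψ).trans hψ) hX⟩
  obtain ⟨e⟩ := nonempty_iso_of_coreflections c.leftOrth_H c'.leftOrth_H
    (hcolocal c.isColocal) (hcolocal (c'.isColocal.comp hf))
  have hc' := reflection_of_triangle c'.triangle c'.strongLeftOrth_G
  refine nonempty_iso_of_reflections (W := S.RightOrth (Set.Ioi a)) (q' := e.hom ≫ c'.p)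
    (rightOrth_of_mem c.mem fun _ hφ => hφ) (rightOrth_of_mem c'.mem fun _ hφ => hφ)
    (reflection_of_triangle c.triangle c.strongLeftOrth_G) fun Y hY => ⟨fun x => ?_, fun y hy => ?_⟩
  · obtain ⟨y, hy⟩ := (hc' Y hY).1 (e.inv ≫ x)
    exact ⟨y, by simp [hy]⟩
  · rw [Category.assoc] at hy
    exact (hc' Y hY).2 y (by rwa [← cancel_epi e.hom, comp_zero])

/-- If composition with `f : F' ⟶ F` is bijective on morphisms to objects right orthogonal to
phases above `a`, then `F` and `F'` have the same HN factor of phase `a`. -/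
lemma HNCut.nonempty_iso_of_isLocal {a : ℝ} {F F' A A' : D} (c : S.HNCut a F A)
    (c' : S.HNCut a F' A') {f : F' ⟶ F}
    (hf : ∀ Y, S.RightOrth (Set.Ioi a) Y →
      (∀ x : F' ⟶ Y, ∃ y, f ≫ y = x) ∧ ∀ y : F ⟶ Y, f ≫ y = 0 → y = 0) :
    Nonempty (A ≅ A') := by
  obtain ⟨Q, q, r, hQ, hq, hr⟩ := c.exists_quotient
  obtain ⟨Q', q', r', hQ', hq', hr'⟩ := c'.exists_quotient
  obtain ⟨e⟩ := nonempty_iso_of_reflections (q := f ≫ q) (q' := q') hQ hQ'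
    (fun Y hY => ⟨fun x => by
      obtain ⟨y, rfl⟩ := (hf Y hY).1 x
      obtain ⟨z, rfl⟩ := (hq Y hY).1 y
      exact ⟨z, Category.assoc _ _ _⟩, fun y hy => by
      rw [Category.assoc] at hy
      exact (hq Y hY).2 y ((hf Y hY).2 _ hy)⟩) hq'
  have hmem : ∀ {B : D}, B ∈ S.P a → S.LeftOrth (Set.Iio a) B :=
    fun hB => leftOrth_of_mem hB fun _ hψ => hψ
  refine nonempty_iso_of_coreflections (i' := r' ≫ e.inv) (hmem c.mem) (hmem c'.mem) hr
    fun X hX => ⟨fun x => ?_, fun y hy => ?_⟩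
  · obtain ⟨y, hy⟩ := (hr' X hX).1 (x ≫ e.hom)
    exact ⟨y, by simp [reassoc_of% hy]⟩
  · rw [← Category.assoc] at hy
    exact (hr' X hX).2 y (by rwa [← cancel_mono e.inv, zero_comp])

/-- A triangle whose third term has phases above `a + 1` induces bijections on morphisms to
objects right orthogonal to phases above `a`. -/
lemma isLocal_of_triangle {a : ℝ} {F F' E : D} {f : F' ⟶ F} {g : F ⟶ E}
    {h : E ⟶ F'⟦(1 : ℤ)⟧} (hT : Triangle.mk f g h ∈ distTriang D)
    (hE : S.StrongLeftOrth (Set.Ioi (a + 1)) E) (Y : D) (hY : S.RightOrth (Set.Ioi a) Y) :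
    (∀ x : F' ⟶ Y, ∃ y, f ≫ y = x) ∧ ∀ y : F ⟶ Y, f ≫ y = 0 → y = 0 := by
  refine ⟨fun x => ?_, fun y hy => ?_⟩
  · obtain ⟨z, hz⟩ : ∃ z : F⟦(1 : ℤ)⟧ ⟶ Y⟦(1 : ℤ)⟧, x⟦(1 : ℤ)⟧' = (-f⟦(1 : ℤ)⟧') ≫ z :=
      Triangle.yoneda_exact₃ _ (rot_of_distTriang _ hT) (x⟦(1 : ℤ)⟧') (hE _ hY.shift _)
    obtain ⟨y, rfl⟩ := (shiftFunctor D (1 : ℤ)).map_surjective z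
    refine ⟨-y, (shiftFunctor D (1 : ℤ)).map_injective ?_⟩
    rw [hz]
    simp
  · obtain ⟨z, hz⟩ : ∃ z : E ⟶ Y, y = g ≫ z := Triangle.yoneda_exact₂ _ hT y hy
    have hz0 : z = 0 :=
      hE Y (hY.mono (Set.Ioi_subset_Ioi (lt_add_one a).le)) z
    rw [hz, hz0, comp_zero]

end Slicing

/-- Fu–Li–Zhao, Lemma 2.9 (1).
Let `σ` be a stability condition on `D^b(X)`, `g : F → E` a morphism, and
`F̃ := Cone(F → E)[-1]` (so that there is a distinguished triangle
`F̃ → F --g--> E → F̃[1]`).  Then for every real number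
`a ∉ [φ⁻(E) - 1, φ⁺(E)]`, the Harder–Narasimhan factor of `F` of phase `a` is
isomorphic to the Harder–Narasimhan factor of `F̃` of phase `a`:
`HN_σ^a(F) ≅ HN_σ^a(F̃)`. -/
theorem hn_factor_iso_of_cone
    (σ : StabilityCondition.{w} D) {F E : D} (g : F ⟶ E)
    (Ftilde : D) (f' : Ftilde ⟶ F) (h' : E ⟶ Ftilde⟦(1 : ℤ)⟧)
    (htri : Triangle.mk f' g h' ∈ (distTriang D))
    (a : ℝ) (ha : a ∉ Set.Icc (σ.slicing.phaseMinus E - 1) (σ.slicing.phasePlus E))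
    (A A' : D) (hA : σ.slicing.IsHNFactorAt a F A)
    (hA' : σ.slicing.IsHNFactorAt a Ftilde A') :
    Nonempty (A ≅ A') := by
  obtain ⟨A₀, ⟨e⟩, ⟨c⟩⟩ := hA.exists_hnCut
  obtain ⟨A₀', ⟨e'⟩, ⟨c'⟩⟩ := hA'.exists_hnCut
  obtain ⟨h⟩ := σ.slicing.hn_exists E
  suffices Nonempty (A₀ ≅ A₀') from this.map fun t => e.symm ≪≫ t ≪≫ e'
  rw [Set.mem_Icc, not_and_or, not_le, not_le] at ha
  rcases ha with ha | ha
  · refine c.nonempty_iso_of_isLocal c' (Slicing.isLocal_of_triangle htri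
      (h.strongLeftOrth fun i => ?_))
    exact (lt_sub_iff_add_lt.1 ha).trans_le (Slicing.phaseMinus_le_phase h i)
  · refine c.nonempty_iso_of_isColocal c' (Slicing.isColocal_of_triangle htri
      fun X hX x => h.hom_to_eq_zero hX (fun i => ?_) x)
    exact (Slicing.phase_le_phasePlus h i).trans_lt ha

end BridgelandStability
end
end

section
/- Let σ be a numerical stability condition on D^b(X) for a smooth projective variety X, let g: F → E be a morphism in D^b(X) with E nonzero, and set F̃ := Cone(F → E)[−1]. If the second smallest phase occurring among the Harder–Narasimhan factors of E is greater than φ⁻(E) + 1, then the truncated Harder–Narasimhan factors HN_σ^{≤ φ⁻(E)}(F) and HN_σ^{≤ φ⁻(E)}(F̃) are not isomorphic. -/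
/-!
# Bridgeland stability conditions: basic framework

We formalize slicings, Harder–Narasimhan filtrations, pre-stability conditions and
(numerical) stability conditions on a pretriangulated category `D`, following
Bridgeland and the conventions of Fu–Li–Zhao, "Stability manifolds of varieties with
finite Albanese morphisms".
-/

open CategoryTheory CategoryTheory.Limits CategoryTheory.Pretriangulated
open scoped TensorProduct ENNReal

noncomputable section

namespace BridgelandStability

universe w v u

variable (D : Type u) [Category.{v} D] [HasZeroObject D] [Preadditive D]
  [HasShift D ℤ] [∀ n : ℤ, (CategoryTheory.shiftFunctor D n).Additive] [Pretriangulated D]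

variable {D}

variable (D)

variable {D}

variable (D)

variable (V : Type) [NormedAddCommGroup V] [NormedSpace ℝ V] [FiniteDimensional ℝ V]

variable {D V}

lemma exists_eq_comp_of_comp_shift_eq_zero {X Y A Z : D} {f : X ⟶ Y} {g : Y ⟶ A}
    {h : A ⟶ X⟦(1 : ℤ)⟧} (hT : Triangle.mk f g h ∈ distTriang D) (s : X ⟶ Z)
    (hs : h ≫ s⟦(1 : ℤ)⟧' = 0) : ∃ k : Y ⟶ Z, s = f ≫ k := by
  obtain ⟨k, hk⟩ : ∃ k : Y⟦(1 : ℤ)⟧ ⟶ Z⟦(1 : ℤ)⟧, s⟦(1 : ℤ)⟧' = (-f⟦(1 : ℤ)⟧') ≫ k :=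
    Triangle.yoneda_exact₂ _ (rot_of_distTriang _ (rot_of_distTriang _ hT)) (s⟦(1 : ℤ)⟧') hs
  obtain ⟨k, rfl⟩ := (shiftFunctor D (1 : ℤ)).map_surjective k
  refine ⟨-k, (shiftFunctor D (1 : ℤ)).map_injective ?_⟩
  rw [hk, Functor.map_comp, Functor.map_neg, Preadditive.neg_comp, Preadditive.comp_neg]

namespace Slicing

/-- `X` receives only zero morphisms from semistable objects of phase greater than `c`. -/
def IsLE (S : Slicing D) (c : ℝ) (X : D) : Prop :=
  ∀ ⦃φ : ℝ⦄, c < φ → ∀ ⦃T : D⦄, T ∈ S.P φ → ∀ f : T ⟶ X, f = 0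

/-- `X` has only zero morphisms to objects satisfying `IsLE c`. -/
def IsGT (S : Slicing D) (c : ℝ) (X : D) : Prop :=
  ∀ ⦃Y : D⦄, S.IsLE c Y → ∀ f : X ⟶ Y, f = 0

variable {S : Slicing D} {c : ℝ} {X : D}

lemma isLE_of_mem {ψ : ℝ} (hX : X ∈ S.P ψ) (hψ : ψ ≤ c) : S.IsLE c X :=
  fun _ hφ _ hT f => S.hom_vanish (hψ.trans_lt hφ) hT hX f

lemma IsLE.mono {d : ℝ} (hX : S.IsLE c X) (hcd : c ≤ d) : S.IsLE d X :=
  fun _ hφ _ hT f => hX (hcd.trans_lt hφ) hT f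

lemma IsLE.shift_one (hX : S.IsLE c X) : S.IsLE (c + 1) (X⟦(1 : ℤ)⟧) := by
  intro φ hφ T hT f
  let e : (T⟦(-1 : ℤ)⟧)⟦(1 : ℤ)⟧ ≅ T := (shiftFunctorCompIsoId D (-1 : ℤ) 1 (by norm_num)).app T
  have hT' : T⟦(-1 : ℤ)⟧ ∈ S.P (φ - 1) := by
    rw [S.shift_mem, sub_add_cancel]
    exact S.iso_closed _ _ _ hT ⟨e.symm⟩
  have h0 := hX (by linarith) hT' ((shiftFunctor D (1 : ℤ)).preimage (e.hom ≫ f))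
  have h1 := (shiftFunctor D (1 : ℤ)).map_preimage (e.hom ≫ f)
  rw [h0, Functor.map_zero] at h1
  rw [← cancel_epi e.hom, ← h1, comp_zero]

lemma IsLE.shift_neg_one (hX : S.IsLE c X) : S.IsLE c (X⟦(-1 : ℤ)⟧) := by
  intro φ hφ T hT f
  let e : (X⟦(-1 : ℤ)⟧)⟦(1 : ℤ)⟧ ≅ X := (shiftFunctorCompIsoId D (-1 : ℤ) 1 (by norm_num)).app X
  apply (shiftFunctor D (1 : ℤ)).map_injective
  rw [Functor.map_zero, ← cancel_mono e.hom, zero_comp]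
  exact hX (by linarith) ((S.shift_mem φ T).1 hT) _

lemma IsGT.shift_one (hX : S.IsGT c X) : S.IsGT c (X⟦(1 : ℤ)⟧) := by
  intro Y hY f
  let e : (Y⟦(-1 : ℤ)⟧)⟦(1 : ℤ)⟧ ≅ Y := (shiftFunctorCompIsoId D (-1 : ℤ) 1 (by norm_num)).app Y
  have h0 := hX hY.shift_neg_one ((shiftFunctor D (1 : ℤ)).preimage (f ≫ e.inv))
  have h1 := (shiftFunctor D (1 : ℤ)).map_preimage (f ≫ e.inv)
  rw [h0, Functor.map_zero] at h1
  rw [← cancel_mono e.inv, ← h1, zero_comp]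

lemma IsGT.shift_one_hom_eq_zero (hX : S.IsGT c X) {Y : D} (hY : S.IsLE c Y)
    (f : X⟦(1 : ℤ)⟧ ⟶ Y⟦(1 : ℤ)⟧) : f = 0 := by
  rw [← (shiftFunctor D (1 : ℤ)).map_preimage f, hX hY ((shiftFunctor D (1 : ℤ)).preimage f),
    Functor.map_zero]

lemma isGT_obj (h : HNFiltration D S.P X) (k : Fin (h.n + 1))
    (hk : ∀ i : Fin h.n, i.castSucc < k → c < h.phase i) : S.IsGT c (h.obj k) := by
  intro Y hY
  induction k using Fin.induction with
  | zero => exact fun f => h.obj_zero.eq_of_src f 0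
  | succ i ih =>
    intro f
    obtain ⟨a, b, d, hT⟩ := h.factor_triangle i
    have hi := ih (fun j hj => hk j (hj.trans i.castSucc_lt_succ)) (a ≫ f)
    obtain ⟨l, hl⟩ := Triangle.yoneda_exact₂ _ hT f hi
    rw [hl, hY (hk i i.castSucc_lt_succ) (h.factor_mem i) l]
    exact comp_zero

lemma isLE_obj (h : HNFiltration D S.P X) (hc : ∀ i, h.phase i ≤ c) (k : Fin (h.n + 1)) :
    S.IsLE c (h.obj k) := by
  intro φ hφ T hT
  induction k using Fin.induction with
  | zero => exact fun f => h.obj_zero.eq_of_tgt f 0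
  | succ i ih =>
    intro f
    obtain ⟨a, b, d, hT'⟩ := h.factor_triangle i
    obtain ⟨l, hl⟩ := Triangle.coyoneda_exact₂ _ hT' f
      (S.hom_vanish ((hc i).trans_lt hφ) hT (h.factor_mem i) _)
    rw [hl, ih l]
    exact zero_comp

lemma isGT_of_memSlice (hX : S.memSlice (Set.Ioi c) X) : S.IsGT c X := by
  obtain ⟨h, hc⟩ := hX
  simpa only [h.obj_last] using isGT_obj h (Fin.last h.n) (fun i _ => hc i)

lemma isLE_of_memSlice (hX : S.memSlice (Set.Iic c) X) : S.IsLE c X := by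
  obtain ⟨h, hc⟩ := hX
  simpa only [h.obj_last] using isLE_obj h hc (Fin.last h.n)

/-- The fibre of a morphism from an object satisfying `IsLE c` to one satisfying
`IsLE (c + 1)` satisfies `IsLE c`. -/
lemma isLE_of_distTriang {K B A : D} {a : K ⟶ B} {b : B ⟶ A} {d : A ⟶ K⟦(1 : ℤ)⟧}
    (hT : Triangle.mk a b d ∈ distTriang D) (hB : S.IsLE c B) (hA : S.IsLE (c + 1) A) :
    S.IsLE c K := by
  intro φ hφ T hTP f
  have hfa : f ≫ a = 0 := hB hφ hTP _
  obtain ⟨l, hl⟩ : ∃ l : T⟦(1 : ℤ)⟧ ⟶ A, f⟦(1 : ℤ)⟧' = l ≫ d :=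
    Triangle.coyoneda_exact₁ _ hT (f⟦(1 : ℤ)⟧')
      (show f⟦(1 : ℤ)⟧' ≫ a⟦(1 : ℤ)⟧' = 0 by rw [← Functor.map_comp, hfa, Functor.map_zero])
  apply (shiftFunctor D (1 : ℤ)).map_injective
  rw [Functor.map_zero, hl, hA (by linarith) ((S.shift_mem φ T).1 hTP) l, zero_comp]

/-- The last step of a Harder–Narasimhan filtration of a nonzero object. -/
lemma exists_last_triangle {E : D} (h : HNFiltration D S.P E) (hE : ¬ IsZero E) :
    ∃ (i : Fin h.n) (W : D) (a : W ⟶ E) (b : E ⟶ h.factor i) (d : h.factor i ⟶ W⟦(1 : ℤ)⟧),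
      Triangle.mk a b d ∈ distTriang D ∧ (∀ j, h.phase i ≤ h.phase j) ∧
      ∀ c, (∀ j, j ≠ i → c < h.phase j) → S.IsGT c W := by
  obtain ⟨n, phase, hanti, obj, h0, hl, factor, hmem, hnz, htri⟩ := h
  subst hl
  cases n with
  | zero => exact absurd h0 hE
  | succ n =>
    obtain ⟨a, b, d, hT⟩ := htri (Fin.last n)
    refine ⟨Fin.last n, obj (Fin.last n).castSucc, a, b, d, hT,
      fun j => hanti.antitone (Fin.le_last j), fun c hc => ?_⟩
    exact isGT_obj ⟨n + 1, phase, hanti, obj, h0, rfl, factor, hmem, hnz, htri⟩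
      (Fin.last n).castSucc (fun j hj => hc j (Fin.castSucc_lt_castSucc_iff.1 hj).ne)

/-- The smallest phase of one Harder–Narasimhan filtration bounds the phases of every other. -/
lemma le_phase_of_forall_le {E : D} (hE : ¬ IsZero E) (h h' : HNFiltration D S.P E) {m : ℝ}
    (hm : ∀ j, m ≤ h.phase j) (j : Fin h'.n) : m ≤ h'.phase j := by
  obtain ⟨i, W, a, b, d, hT, hmin, hW⟩ := exists_last_triangle h' hE
  refine le_trans ?_ (hmin j)
  by_contra! hlt
  have hA : S.IsLE (h'.phase i) (h'.factor i) := isLE_of_mem (h'.factor_mem i) le_rfl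
  have hEgt : S.IsGT (h'.phase i) E :=
    isGT_of_memSlice ⟨h, fun k => hlt.trans_le (hm k)⟩
  have hWgt : S.IsGT (h'.phase i) W := hW _ fun k hk =>
    lt_of_le_of_ne (hmin k) fun he => hk (h'.phase_strictAnti.injective he.symm)
  apply h'.factor_nonzero i
  rw [IsZero.iff_id_eq_zero]
  obtain ⟨l, hl⟩ := Triangle.yoneda_exact₃ _ hT (𝟙 (h'.factor i)) (hEgt hA _)
  refine hl.trans ?_
  rw [hWgt.shift_one hA l]
  exact comp_zero

lemma phaseMinus_eq {E : D} (hE : ¬ IsZero E) (h : HNFiltration D S.P E) (i : Fin h.n)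
    (hi : ∀ j, h.phase i ≤ h.phase j) : S.phaseMinus E = h.phase i := by
  refine IsLeast.csInf_eq ⟨⟨h, i, rfl⟩, ?_⟩
  rintro _ ⟨hn, j, rfl⟩
  exact le_phase_of_forall_le hE h hn hi j

/-- `q : X ⟶ Q` is universal among morphisms from `X` to objects satisfying `IsLE c`. -/
def IsReflection (S : Slicing D) (c : ℝ) {X Q : D} (q : X ⟶ Q) : Prop :=
  S.IsLE c Q ∧ ∀ ⦃Y : D⦄, S.IsLE c Y → Function.Bijective fun s : Q ⟶ Y => q ≫ s

lemma IsReflection.nonempty_iso {Q Q' : D} {q : X ⟶ Q} {q' : X ⟶ Q'}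
    (hq : S.IsReflection c q) (hq' : S.IsReflection c q') : Nonempty (Q ≅ Q') := by
  obtain ⟨u, hu⟩ := (hq.2 hq'.1).2 q'
  obtain ⟨w, hw⟩ := (hq'.2 hq.1).2 q
  dsimp only at hu hw
  refine ⟨⟨u, w, (hq.2 hq.1).1 ?_, (hq'.2 hq'.1).1 ?_⟩⟩
  · simp [reassoc_of% hu, hw]
  · simp [reassoc_of% hw, hu]

lemma isReflection_of_distTriang {W Q : D} {a : W ⟶ X} {q : X ⟶ Q} {d : Q ⟶ W⟦(1 : ℤ)⟧}
    (hT : Triangle.mk a q d ∈ distTriang D) (hW : S.IsGT c W) (hQ : S.IsLE c Q) :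
    S.IsReflection c q := by
  refine ⟨hQ, fun Y hY => ⟨fun s t hst => ?_, fun s => ?_⟩⟩
  · dsimp only at hst
    obtain ⟨l, hl⟩ := Triangle.yoneda_exact₃ _ hT (s - t)
      (show q ≫ (s - t) = 0 by rw [Preadditive.comp_sub, hst, sub_self])
    rw [hW.shift_one hY l] at hl
    exact sub_eq_zero.1 (hl.trans comp_zero)
  · obtain ⟨l, hl⟩ := Triangle.yoneda_exact₂ _ hT s (hW hY _)
    exact ⟨l, hl.symm⟩

/-- Given a morphism `(q, p, r)` from a distinguished triangle `F' ⟶ F ⟶ E` to a distinguished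
triangle `K ⟶ Y ⟶ A` such that `p` and `r` are given by truncation at `c`, with the kernel of `r`
in phases greater than `c + 1`, the morphism `q` is again the truncation at `c`. -/
lemma isReflection_of_triangle_morphism {F' F E K Y A WF WE : D}
    {f : F' ⟶ F} {g : F ⟶ E} {h : E ⟶ F'⟦(1 : ℤ)⟧} (hT : Triangle.mk f g h ∈ distTriang D)
    {a : K ⟶ Y} {b : Y ⟶ A} {d : A ⟶ K⟦(1 : ℤ)⟧} (hT' : Triangle.mk a b d ∈ distTriang D)
    {wF : WF ⟶ F} {p : F ⟶ Y} {dF : Y ⟶ WF⟦(1 : ℤ)⟧}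
    (hF : Triangle.mk wF p dF ∈ distTriang D) (hWF : S.IsGT c WF)
    {wE : WE ⟶ E} {r : E ⟶ A} {dE : A ⟶ WE⟦(1 : ℤ)⟧}
    (hE : Triangle.mk wE r dE ∈ distTriang D) (hWE : S.IsGT (c + 1) WE)
    (hY : S.IsLE c Y) (hA : S.IsLE c A) {q : F' ⟶ K}
    (hfp : f ≫ p = q ≫ a) (hgr : g ≫ r = p ≫ b) (hhq : h ≫ q⟦(1 : ℤ)⟧' = r ≫ d) :
    S.IsReflection c q := by
  have hK : S.IsLE c K := isLE_of_distTriang hT' hY (hA.mono (by linarith))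
  have hp := isReflection_of_distTriang hF hWF hY
  have hr : S.IsReflection (c + 1) r :=
    isReflection_of_distTriang hE hWE (hA.mono (by linarith))
  have hgh : g ≫ h = 0 := comp_distTriang_mor_zero₂₃ _ hT
  have hab : a ≫ b = 0 := comp_distTriang_mor_zero₁₂ _ hT'
  refine ⟨hK, fun Z hZ => ⟨?_, fun s => ?_⟩⟩
  · suffices hinj : ∀ s : K ⟶ Z, q ≫ s = 0 → s = 0 from fun s t hst =>
      sub_eq_zero.1 (hinj _ (by rw [Preadditive.comp_sub]; exact sub_eq_zero.2 hst))
    intro s hs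
    have hds : d ≫ s⟦(1 : ℤ)⟧' = 0 := by
      apply (hr.2 hZ.shift_one).1
      dsimp only
      rw [← Category.assoc, ← hhq, Category.assoc, ← Functor.map_comp, hs, Functor.map_zero,
        comp_zero, comp_zero]
    obtain ⟨k, hk⟩ := exists_eq_comp_of_comp_shift_eq_zero hT' s hds
    obtain ⟨l, hl⟩ := Triangle.yoneda_exact₂ _ hT (p ≫ k)
      (show f ≫ p ≫ k = 0 by rw [reassoc_of% hfp, ← hk, hs])
    change p ≫ k = g ≫ l at hl
    obtain ⟨m, rfl⟩ := (hr.2 (hZ.mono (by linarith))).2 l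
    have hkm : k = b ≫ m := by
      apply (hp.2 hZ).1
      dsimp only
      rw [hl, reassoc_of% hgr]
    rw [hk, hkm, reassoc_of% hab, zero_comp]
  · obtain ⟨t, ht⟩ := (hr.2 hZ.shift_one).2 (h ≫ s⟦(1 : ℤ)⟧')
    dsimp only at ht
    have hbt : b ≫ t = 0 := by
      obtain ⟨l, hl⟩ := Triangle.yoneda_exact₃ _ hF (b ≫ t)
        (show p ≫ b ≫ t = 0 by rw [← reassoc_of% hgr, ht, reassoc_of% hgh, zero_comp])
      rw [hWF.shift_one_hom_eq_zero hZ l] at hl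
      exact hl.trans comp_zero
    obtain ⟨u, hu⟩ : ∃ u : K⟦(1 : ℤ)⟧ ⟶ Z⟦(1 : ℤ)⟧, t = d ≫ u :=
      Triangle.yoneda_exact₃ _ hT' t hbt
    obtain ⟨s', rfl⟩ := (shiftFunctor D (1 : ℤ)).map_surjective u
    have hdiff : h ≫ (s - q ≫ s')⟦(1 : ℤ)⟧' = 0 := by
      rw [Functor.map_sub, Preadditive.comp_sub, Functor.map_comp, reassoc_of% hhq, ← hu, ht,
        sub_self]
    obtain ⟨k, hk⟩ := exists_eq_comp_of_comp_shift_eq_zero hT (s - q ≫ s') hdiff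
    obtain ⟨k', rfl⟩ := (hp.2 hZ).2 k
    refine ⟨s' + a ≫ k', ?_⟩
    dsimp only at hk ⊢
    rw [Preadditive.comp_add, ← reassoc_of% hfp, ← hk]
    abel

end Slicing

lemma PreStability.Z_eq_of_iso (σ : PreStability D) {X Y : D} (e : X ≅ Y) : σ.Z X = σ.Z Y := by
  obtain ⟨C, a, b, hT⟩ := distinguished_cocone_triangle e.hom
  have hC : IsZero C := Triangle.isZero₃_of_isIso₁ _ hT (inferInstanceAs (IsIso e.hom))
  have h : σ.Z Y = σ.Z X + σ.Z C := σ.Z_additive _ hT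
  rw [h, σ.Z_zero C hC, add_zero]

lemma PreStability.Z_ne_zero (σ : PreStability D) {φ : ℝ} {X : D} (hX : X ∈ σ.slicing.P φ)
    (h0 : ¬ IsZero X) : σ.Z X ≠ 0 := by
  obtain ⟨m, hm, hZ⟩ := σ.Z_phase φ X hX h0
  rw [hZ]
  exact mul_ne_zero (Complex.ofReal_ne_zero.2 hm.ne') (Complex.exp_ne_zero _)

/-- Fu–Li–Zhao, Lemma 2.9 (2).
Let `σ` be a numerical stability condition on `D^b(X)` (`X` smooth projective, with
Euler pairing `euler`), `g : F → E` a morphism with `E ≠ 0`, and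
`F̃ := Cone(F → E)[-1]` (so there is a distinguished triangle `F̃ → F --g--> E → F̃[1]`).
If the second smallest phase of the Harder–Narasimhan factors of `E` is greater than
`φ⁻(E) + 1` (i.e. every HN phase of `E` other than `φ⁻(E)` exceeds `φ⁻(E) + 1`), then
the truncated Harder–Narasimhan factors `HN_σ^{≤ φ⁻(E)}(F)` and `HN_σ^{≤ φ⁻(E)}(F̃)`
are not isomorphic. -/
theorem hn_trunc_not_iso_of_cone
    (σ : StabilityCondition.{w} D)
    (euler : D → D → ℤ)
    (euler_add_fst : ∀ T : Triangle D, T ∈ (distTriang D) →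
      ∀ G : D, euler T.obj₂ G = euler T.obj₁ G + euler T.obj₃ G)
    (euler_add_snd : ∀ (G : D) (T : Triangle D), T ∈ (distTriang D) →
      euler G T.obj₂ = euler G T.obj₁ + euler G T.obj₃)
    (hnum : σ.IsNumerical euler)
    {F E : D} (g : F ⟶ E) (hE : ¬ IsZero E)
    (Ftilde : D) (f' : Ftilde ⟶ F) (h' : E ⟶ Ftilde⟦(1 : ℤ)⟧)
    (htri : Triangle.mk f' g h' ∈ (distTriang D))
    (hsecond : ∀ φ ∈ σ.slicing.hnPhases E, φ ≠ σ.slicing.phaseMinus E →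
      σ.slicing.phaseMinus E + 1 < φ)
    (Y Y' : D) (hY : σ.slicing.IsHNTruncLE (σ.slicing.phaseMinus E) F Y)
    (hY' : σ.slicing.IsHNTruncLE (σ.slicing.phaseMinus E) Ftilde Y') :
    ¬ Nonempty (Y ≅ Y') := by
  rintro ⟨e⟩
  obtain ⟨hn⟩ := σ.slicing.hn_exists E
  obtain ⟨i, WE, wE, r, dE, hEtri, hmin, hWE⟩ := Slicing.exists_last_triangle hn hE
  have hc := Slicing.phaseMinus_eq hE hn i hmin
  obtain ⟨WF, wF, p, dF, hFtri, hWF, hYle⟩ := hY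
  obtain ⟨W', w', p', d', hFtri', hW', hYle'⟩ := hY'
  generalize σ.slicing.phaseMinus E = c at *
  have hWE' : σ.slicing.IsGT (c + 1) WE := hWE _ fun j hj =>
    hsecond _ ⟨hn, j, rfl⟩ fun h => hj (hn.phase_strictAnti.injective (h.trans hc))
  have hA : σ.slicing.IsLE c (hn.factor i) := Slicing.isLE_of_mem (hn.factor_mem i) hc.ge
  obtain ⟨b, hb⟩ := Triangle.yoneda_exact₂ _ hFtri (g ≫ r) (Slicing.isGT_of_memSlice hWF hA _)
  obtain ⟨K, a, d, hKtri⟩ := distinguished_cocone_triangle₁ b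
  obtain ⟨q, hq, hq'⟩ := complete_distinguished_triangle_morphism₁ _ _ htri hKtri p r hb
  have hrefl := Slicing.isReflection_of_triangle_morphism htri hKtri hFtri
    (Slicing.isGT_of_memSlice hWF) hEtri hWE' (Slicing.isLE_of_memSlice hYle) hA hq hb hq'
  obtain ⟨e'⟩ := hrefl.nonempty_iso (Slicing.isReflection_of_distTriang hFtri'
    (Slicing.isGT_of_memSlice hW') (Slicing.isLE_of_memSlice hYle'))
  have hZ : σ.Z Y = σ.Z K + σ.Z (hn.factor i) := σ.Z_additive _ hKtri
  rw [σ.Z_eq_of_iso e, σ.Z_eq_of_iso e', left_eq_add] at hZ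
  exact σ.Z_ne_zero (hn.factor_mem i) (hn.factor_nonzero i) hZ

end BridgelandStability
end
end
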